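/- arXiv:2206.09879 — 3 statements merged into one kernel-verified Lean document; each statement's English description precedes it below -/
import Mathlib

section
/- Spectrum of the non-Hermitian evolution with non-normal dissipators (Proposition 5.3, general formula): Let G > 0, δ ∈ [0, 2π], and let 𝒯 be the bounded operator on ℓ²(ℤ×ℤ) defined by (𝒯ψ)(x,y) = (i + G·e^{iδ})·ψ(x+1,y) + (i + G·e^{−iδ})·ψ(x−1,y) + (−i + G·e^{iδ})·ψ(x,y−1) + (−i + G·e^{−iδ})·ψ(x,y+1) − 4G·ψ(x,y). (This is the vectorized non-Hermitian evolution for Hamiltonian H = −(S + S*) and Lindblad operators L_k = (|e_k⟩ + e^{iδ}|e_{k+1}⟩)(⟨e_k| − e^{−iδ}⟨e_{k+1}|), k ∈ ℤ.) Then σ(𝒯) = { −4G + 2i·cos θ − 2i·cos(q − θ) + 2G·cos(δ + θ) + 2G·cos(q − δ − θ) : q, θ ∈ ℝ }. -/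
section BanachAlgebra

variable {A : Type*} [NormedRing A] [NormedAlgebra ℂ A] [CompleteSpace A]

/-- The spectrum of an element of the bicommutant of a commuting set consists of the values at it
of the characters of the bicommutant. -/
theorem mem_spectrum_iff_exists_algHom_centralizer_centralizer {s : Set A}
    (hs : ∀ a ∈ s, ∀ b ∈ s, a * b = b * a)
    (x : Subalgebra.centralizer ℂ (Set.centralizer s)) (l : ℂ) :
    l ∈ spectrum ℂ (x : A) ↔
      ∃ φ : Subalgebra.centralizer ℂ (Set.centralizer s) →ₐ[ℂ] ℂ, φ x = l := by
  let B := Subalgebra.centralizer ℂ (Set.centralizer s)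
  change B at x
  change _ ↔ ∃ φ : B →ₐ[ℂ] ℂ, φ x = l
  have hcomm (a b : B) : a * b = b * a :=
    Subtype.ext (Set.centralizer_centralizer_comm_of_comm hs a a.2 b b.2)
  let _ : NormedCommRing B := { (inferInstance : NormedRing B) with mul_comm := hcomm }
  have : CompleteSpace B :=
    (Set.isClosed_centralizer (Set.centralizer s)).completeSpace_coe
  have hspec : spectrum ℂ (x : A) = spectrum ℂ x := by
    refine (spectrum.subset_subalgebra x).antisymm fun l hl hu ↦ hl ?_
    obtain ⟨u, hu⟩ := hu
    have hu' : (u : A) ∈ B := by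
      rw [hu]
      exact (algebraMap ℂ B l - x).2
    have hinv : ((u⁻¹ : Aˣ) : A) ∈ B := by
      rw [Subalgebra.mem_centralizer_iff] at hu' ⊢
      exact fun g hg ↦ (Commute.units_inv_right (hu' g hg)).eq
    refine ⟨⟨algebraMap ℂ B l - x, ⟨_, hinv⟩, Subtype.ext ?_, Subtype.ext ?_⟩, rfl⟩
    · change (algebraMap ℂ A l - x) * ((u⁻¹ : Aˣ) : A) = 1
      rw [← hu, Units.mul_inv]
    · change ((u⁻¹ : Aˣ) : A) * (algebraMap ℂ A l - x) = 1
      rw [← hu, Units.inv_mul]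
  rw [hspec, WeakDual.CharacterSpace.mem_spectrum_iff_exists]
  constructor
  · rintro ⟨f, rfl⟩
    exact ⟨WeakDual.CharacterSpace.toAlgHom f, rfl⟩
  · rintro ⟨φ, rfl⟩
    exact WeakDual.CharacterSpace.mem_spectrum_iff_exists.1 (AlgHom.apply_mem_spectrum φ x)

variable [NormOneClass A]

/-- For commuting units `u`, `v` of norm at most one with inverses of norm at most one, which
inner automorphisms multiply by arbitrary phases, the spectrum of
`α u + β u⁻¹ + γ v⁻¹ + κ v + c` is the range of its symbol on the torus. -/
theorem spectrum_eq_range_symbol (u v : Aˣ) (huv : Commute u v)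
    (hu : ‖(u : A)‖ ≤ 1) (hu' : ‖((u⁻¹ : Aˣ) : A)‖ ≤ 1)
    (hv : ‖(v : A)‖ ≤ 1) (hv' : ‖((v⁻¹ : Aˣ) : A)‖ ≤ 1)
    (hgauge : ∀ z w : ℂ, ‖z‖ = 1 → ‖w‖ = 1 → ∃ g : Aˣ,
      (g * u * (g⁻¹ : Aˣ) : A) = z • (u : A) ∧ (g * v * (g⁻¹ : Aˣ) : A) = w • (v : A) ∧
      (g * (u⁻¹ : Aˣ) * (g⁻¹ : Aˣ) : A) = z⁻¹ • ((u⁻¹ : Aˣ) : A) ∧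
      (g * (v⁻¹ : Aˣ) * (g⁻¹ : Aˣ) : A) = w⁻¹ • ((v⁻¹ : Aˣ) : A))
    (α β γ κ c : ℂ) :
    spectrum ℂ (α • (u : A) + β • ((u⁻¹ : Aˣ) : A) + γ • ((v⁻¹ : Aˣ) : A) + κ • (v : A) + c • 1) =
      {l | ∃ z w : ℂ, ‖z‖ = 1 ∧ ‖w‖ = 1 ∧
        l = α * z + β * z⁻¹ + γ * w⁻¹ + κ * w + c} := by
  set s : Set A := {(u : A), (v : A)}
  have huv' : (u : A) * v = v * u := by exact_mod_cast congrArg Units.val huv.eq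
  have hs : ∀ a ∈ s, ∀ b ∈ s, a * b = b * a := by
    rintro a (rfl | rfl) b (rfl | rfl) <;> simp [huv']
  set B := Subalgebra.centralizer ℂ (Set.centralizer s)
  have mem_of_mem (t : Aˣ) (ht : (t : A) ∈ s) : (t : A) ∈ B :=
    Set.subset_centralizer_centralizer ht
  have inv_mem_of_mem (t : Aˣ) (ht : (t : A) ∈ s) : ((t⁻¹ : Aˣ) : A) ∈ B := by
    have := mem_of_mem t ht
    rw [Subalgebra.mem_centralizer_iff] at this ⊢
    exact fun g hg ↦ (Commute.units_inv_right (this g hg)).eq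
  let U : Bˣ := ⟨⟨u, mem_of_mem u (by simp [s])⟩, ⟨_, inv_mem_of_mem u (by simp [s])⟩,
    Subtype.ext (by simp), Subtype.ext (by simp)⟩
  let V : Bˣ := ⟨⟨v, mem_of_mem v (by simp [s])⟩, ⟨_, inv_mem_of_mem v (by simp [s])⟩,
    Subtype.ext (by simp), Subtype.ext (by simp)⟩
  let x (α β γ κ : ℂ) : B := α • (U : B) + β • ((U⁻¹ : Bˣ) : B) + γ • ((V⁻¹ : Bˣ) : B)
    + κ • (V : B) + c • 1
  have norm_le (φ : B →ₐ[ℂ] ℂ) (b : B) : ‖φ b‖ ≤ ‖(b : A)‖ := by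
    have : CompleteSpace B :=
      (Set.isClosed_centralizer (Set.centralizer s)).completeSpace_coe
    have : NormOneClass B := ⟨norm_one (α := A)⟩
    exact AlgHom.norm_apply_le_self φ b
  have norm_eq (φ : B →ₐ[ℂ] ℂ) (t : Bˣ) (h : ‖((t : B) : A)‖ ≤ 1)
      (h' : ‖(((t⁻¹ : Bˣ) : B) : A)‖ ≤ 1) : ‖φ t‖ = 1 ∧ φ ((t⁻¹ : Bˣ) : B) = (φ t)⁻¹ := by
    have hmul : φ t * φ ((t⁻¹ : Bˣ) : B) = 1 := by rw [← map_mul, Units.mul_inv, map_one]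
    have h1 := (norm_le φ t).trans h
    have h2 := (norm_le φ ((t⁻¹ : Bˣ) : B)).trans h'
    have h3 : ‖φ t‖ * ‖φ ((t⁻¹ : Bˣ) : B)‖ = 1 := by rw [← norm_mul, hmul, norm_one]
    refine ⟨?_, (inv_eq_of_mul_eq_one_right hmul).symm⟩
    nlinarith [norm_nonneg (φ t), norm_nonneg (φ ((t⁻¹ : Bˣ) : B))]
  have hφ (φ : B →ₐ[ℂ] ℂ) (α β γ κ : ℂ) :
      φ (x α β γ κ) = α * φ U + β * (φ U)⁻¹ + γ * (φ V)⁻¹ + κ * φ V + c := by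
    simp only [x, map_add, map_smul, map_one, (norm_eq φ U hu hu').2, (norm_eq φ V hv hv').2,
      smul_eq_mul, mul_one]
  ext l
  change l ∈ spectrum ℂ ((x α β γ κ : B) : A) ↔ _
  constructor
  · intro hl
    obtain ⟨φ, rfl⟩ := (mem_spectrum_iff_exists_algHom_centralizer_centralizer hs _ _).1 hl
    exact ⟨φ U, φ V, (norm_eq φ U hu hu').1, (norm_eq φ V hv hv').1, hφ φ _ _ _ _⟩
  · rintro ⟨z, w, hz, hw, rfl⟩
    have : Nontrivial A := NormOneClass.nontrivial
    obtain ⟨k, hk⟩ := spectrum.nonempty (((0 : B) : A))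
    obtain ⟨φ, -⟩ := (mem_spectrum_iff_exists_algHom_centralizer_centralizer hs _ _).1 hk
    have hU := (norm_eq φ U hu hu').1
    have hV := (norm_eq φ V hv hv').1
    have hU0 : φ U ≠ 0 := norm_ne_zero_iff.1 (by simp [hU])
    have hV0 : φ V ≠ 0 := norm_ne_zero_iff.1 (by simp [hV])
    obtain ⟨g, h1, h2, h3, h4⟩ := hgauge (z / φ U) (w / φ V) (by simp [hz, hU]) (by simp [hw, hV])
    have hconj : (g * (x α β γ κ : B) * (g⁻¹ : Aˣ) : A) =
        (x (α * (z / φ U)) (β * (z / φ U)⁻¹) (γ * (w / φ V)⁻¹) (κ * (w / φ V)) : B) := by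
      change (g * (α • (u : A) + β • ((u⁻¹ : Aˣ) : A) + γ • ((v⁻¹ : Aˣ) : A) + κ • (v : A) + c • 1)
          * (g⁻¹ : Aˣ) : A) = (α * (z / φ U)) • (u : A) + (β * (z / φ U)⁻¹) • ((u⁻¹ : Aˣ) : A)
          + (γ * (w / φ V)⁻¹) • ((v⁻¹ : Aˣ) : A) + (κ * (w / φ V)) • (v : A) + c • 1
      simp only [mul_add, add_mul, mul_smul_comm, smul_mul_assoc, mul_one, h1, h2, h3, h4,
        Units.mul_inv, smul_smul]
    rw [← spectrum.units_conjugate (u := g), hconj,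
      mem_spectrum_iff_exists_algHom_centralizer_centralizer hs]
    refine ⟨φ, ?_⟩
    rw [hφ]
    field_simp

end BanachAlgebra

section WeightedComposition

variable {ι : Type*}

theorem hasSum_norm_mul_comp (e : ι ≃ ι) (c : ι → ℂ) (hc : ∀ p, ‖c p‖ = 1)
    (ψ : lp (fun _ : ι => ℂ) 2) :
    HasSum (fun p ↦ ‖c p * ψ (e p)‖ ^ (2 : ENNReal).toReal) (‖ψ‖ ^ (2 : ENNReal).toReal) := by
  simp only [norm_mul, hc, one_mul]
  exact e.hasSum_iff.2 (lp.hasSum_norm (by simp) ψ)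

/-- The linear map `ψ ↦ (p ↦ c p * ψ (e p))` on `ℓ²(ι)`, for a permutation `e` of `ι` and
phases `c`. -/
noncomputable def weightedCompLinearMap (e : ι ≃ ι) (c : ι → ℂ) (hc : ∀ p, ‖c p‖ = 1) :
    lp (fun _ : ι => ℂ) 2 →ₗ[ℂ] lp (fun _ : ι => ℂ) 2 where
  toFun ψ := ⟨fun p ↦ c p * ψ (e p), memℓp_gen (hasSum_norm_mul_comp e c hc ψ).summable⟩
  map_add' _ _ := lp.ext (funext fun _ ↦ mul_add _ _ _)
  map_smul' _ _ := lp.ext (funext fun _ ↦ mul_left_comm _ _ _)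

theorem norm_weightedCompLinearMap_le (e : ι ≃ ι) (c : ι → ℂ) (hc : ∀ p, ‖c p‖ = 1)
    (ψ : lp (fun _ : ι => ℂ) 2) : ‖weightedCompLinearMap e c hc ψ‖ ≤ 1 * ‖ψ‖ := by
  rw [one_mul]
  exact lp.norm_le_of_tsum_le (by simp) (norm_nonneg ψ) (hasSum_norm_mul_comp e c hc ψ).tsum_eq.le

/-- `weightedCompLinearMap` as a bounded operator. -/
noncomputable def weightedComp (e : ι ≃ ι) (c : ι → ℂ) (hc : ∀ p, ‖c p‖ = 1) :
    lp (fun _ : ι => ℂ) 2 →L[ℂ] lp (fun _ : ι => ℂ) 2 :=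
  (weightedCompLinearMap e c hc).mkContinuous 1 (norm_weightedCompLinearMap_le e c hc)

theorem weightedComp_apply (e : ι ≃ ι) (c : ι → ℂ) (hc : ∀ p, ‖c p‖ = 1)
    (ψ : lp (fun _ : ι => ℂ) 2) (p : ι) : weightedComp e c hc ψ p = c p * ψ (e p) :=
  rfl

theorem norm_weightedComp_le (e : ι ≃ ι) (c : ι → ℂ) (hc : ∀ p, ‖c p‖ = 1) :
    ‖weightedComp e c hc‖ ≤ 1 :=
  LinearMap.mkContinuous_norm_le _ zero_le_one (norm_weightedCompLinearMap_le e c hc)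

/-- The unit of the algebra of operators on `ℓ²(ι)` given by composition with a permutation. -/
noncomputable def compUnit (e : ι ≃ ι) :
    (lp (fun _ : ι => ℂ) 2 →L[ℂ] lp (fun _ : ι => ℂ) 2)ˣ where
  val := weightedComp e 1 (by simp)
  inv := weightedComp e.symm 1 (by simp)
  val_inv := by
    ext ψ p
    simp [weightedComp_apply]
  inv_val := by
    ext ψ p
    simp [weightedComp_apply]

/-- The unit of the algebra of operators on `ℓ²(ι)` given by multiplication by phases. -/
noncomputable def phaseUnit (c : ι → ℂ) (hc : ∀ p, ‖c p‖ = 1) :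
    (lp (fun _ : ι => ℂ) 2 →L[ℂ] lp (fun _ : ι => ℂ) 2)ˣ where
  val := weightedComp (Equiv.refl ι) c hc
  inv := weightedComp (Equiv.refl ι) c⁻¹ (by simp [hc])
  val_inv := by
    ext ψ p
    have : c p ≠ 0 := norm_ne_zero_iff.1 (by simp [hc])
    simp [weightedComp_apply, this]
  inv_val := by
    ext ψ p
    have : c p ≠ 0 := norm_ne_zero_iff.1 (by simp [hc])
    simp [weightedComp_apply, this]

theorem phaseUnit_conj_compUnit (c : ι → ℂ) (hc : ∀ p, ‖c p‖ = 1) (e : ι ≃ ι) (z : ℂ)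
    (h : ∀ p, c p = z * c (e p)) :
    ((phaseUnit c hc : lp (fun _ : ι => ℂ) 2 →L[ℂ] lp (fun _ : ι => ℂ) 2) * compUnit e *
      ((phaseUnit c hc)⁻¹ : (lp (fun _ : ι => ℂ) 2 →L[ℂ] lp (fun _ : ι => ℂ) 2)ˣ)) =
      z • (compUnit e : lp (fun _ : ι => ℂ) 2 →L[ℂ] lp (fun _ : ι => ℂ) 2) := by
  ext ψ p
  change c p * (1 * ((c (e p))⁻¹ * ψ (e p))) = z * (1 * ψ (e p))
  have : c (e p) ≠ 0 := norm_ne_zero_iff.1 (by simp [hc])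
  rw [h]
  field_simp

end WeightedComposition

/-- Spectra of nearest-neighbour convolution operators on `ℓ²(ℤ×ℤ)`. -/
theorem spectrum_nearestNeighbour (α β γ κ c : ℂ)
    (T : lp (fun _ : ℤ × ℤ => ℂ) 2 →L[ℂ] lp (fun _ : ℤ × ℤ => ℂ) 2)
    (hT : ∀ (ψ : lp (fun _ : ℤ × ℤ => ℂ) 2) (x y : ℤ),
      T ψ (x, y) = α * ψ (x + 1, y) + β * ψ (x - 1, y) + γ * ψ (x, y - 1) + κ * ψ (x, y + 1)
        + c * ψ (x, y)) :
    spectrum ℂ T = {l | ∃ z w : ℂ, ‖z‖ = 1 ∧ ‖w‖ = 1 ∧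
      l = α * z + β * z⁻¹ + γ * w⁻¹ + κ * w + c} := by
  let e : ℤ × ℤ ≃ ℤ × ℤ := (Equiv.addRight 1).prodCongr (Equiv.refl ℤ)
  let f : ℤ × ℤ ≃ ℤ × ℤ := (Equiv.refl ℤ).prodCongr (Equiv.addRight 1)
  have hinv (e : ℤ × ℤ ≃ ℤ × ℤ) : (compUnit e)⁻¹ = compUnit e.symm := Units.ext rfl
  have : Nontrivial (lp (fun _ : ℤ × ℤ => ℂ) 2) :=
    ⟨lp.single 2 0 1, 0, fun h ↦ by simpa using congrArg (fun ψ ↦ ψ 0) h⟩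
  rw [← spectrum_eq_range_symbol (compUnit e) (compUnit f) ?_
    (norm_weightedComp_le e 1 (by simp)) (norm_weightedComp_le e.symm 1 (by simp))
    (norm_weightedComp_le f 1 (by simp)) (norm_weightedComp_le f.symm 1 (by simp)) ?_ α β γ κ c]
  · congr 1
    ext ψ ⟨x, y⟩
    rw [hT]
    change _ = α * (1 * ψ (x + 1, y)) + β * (1 * ψ (x + -1, y)) + γ * (1 * ψ (x, y + -1))
      + κ * (1 * ψ (x, y + 1)) + c * ψ (x, y)
    simp only [one_mul, sub_eq_add_neg]
  · refine Units.ext ?_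
    ext ψ ⟨x, y⟩
    rfl
  · intro z w hz hw
    have hz0 : z ≠ 0 := norm_ne_zero_iff.1 (by simp [hz])
    have hw0 : w ≠ 0 := norm_ne_zero_iff.1 (by simp [hw])
    refine ⟨phaseUnit (fun p ↦ z ^ (-p.1) * w ^ (-p.2)) (by simp [hz, hw]), ?_, ?_, ?_, ?_⟩
    · refine phaseUnit_conj_compUnit _ _ _ _ fun p ↦ ?_
      simp only [e, Equiv.prodCongr_apply, Prod.map, Equiv.coe_addRight, Equiv.refl_apply, neg_add,
        zpow_add₀ hz0, zpow_neg_one]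
      field_simp
    · refine phaseUnit_conj_compUnit _ _ _ _ fun p ↦ ?_
      simp only [f, Equiv.prodCongr_apply, Prod.map, Equiv.coe_addRight, Equiv.refl_apply, neg_add,
        zpow_add₀ hw0, zpow_neg_one]
      field_simp
    · rw [hinv]
      refine phaseUnit_conj_compUnit _ _ _ _ fun p ↦ ?_
      change _ = z⁻¹ * (z ^ (-(p.1 + -1)) * w ^ (-p.2))
      rw [neg_add, neg_neg, zpow_add₀ hz0, zpow_one]
      field_simp
    · rw [hinv]
      refine phaseUnit_conj_compUnit _ _ _ _ fun p ↦ ?_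
      change _ = w⁻¹ * (z ^ (-p.1) * w ^ (-(p.2 + -1)))
      rw [neg_add, neg_neg, zpow_add₀ hw0, zpow_one]
      field_simp

open Complex in
theorem symbol_exp_mul_I (G δ a b : ℝ) :
    (I + (G : ℂ) * exp (I * (δ : ℂ))) * exp (a * I)
      + (I + (G : ℂ) * exp (-I * (δ : ℂ))) * (exp (a * I))⁻¹
      + (-I + (G : ℂ) * exp (I * (δ : ℂ))) * (exp (b * I))⁻¹
      + (-I + (G : ℂ) * exp (-I * (δ : ℂ))) * exp (b * I) + -(4 * (G : ℂ)) =
    -4 * (G : ℂ) + 2 * I * (Real.cos a : ℂ) - 2 * I * (Real.cos b : ℂ)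
      + 2 * (G : ℂ) * (Real.cos (δ + a) : ℂ) + 2 * (G : ℂ) * (Real.cos (b - δ) : ℂ) := by
  have h1 : exp (-I * (δ : ℂ)) = (exp (δ * I))⁻¹ := by rw [← exp_neg]; ring_nf
  have h2 : exp (I * (δ : ℂ)) = exp (δ * I) := by rw [mul_comm]
  push_cast
  rw [h1, h2]
  simp only [Complex.cos, neg_mul, exp_neg, add_mul, sub_mul, exp_add, exp_sub]
  have := exp_ne_zero (a * I)
  have := exp_ne_zero (b * I)
  have := exp_ne_zero (δ * I)
  field_simp
  ring

/-- Spectrum of the non-Hermitian evolution with non-normal dissipators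
`L_k = (|e_k⟩ + e^{iδ}|e_{k+1}⟩)(⟨e_k| - e^{-iδ}⟨e_{k+1}|)`: for the operator
`(𝒯ψ)(x,y) = (i + Ge^{iδ})ψ(x+1,y) + (i + Ge^{-iδ})ψ(x-1,y) + (-i + Ge^{iδ})ψ(x,y-1)
+ (-i + Ge^{-iδ})ψ(x,y+1) - 4Gψ(x,y)` on `ℓ²(ℤ×ℤ)` with `G > 0`, `δ ∈ [0,2π]`,
the spectrum is the set of all
`-4G + 2i cos θ - 2i cos(q-θ) + 2G cos(δ+θ) + 2G cos(q-δ-θ)` for `q, θ ∈ ℝ`. -/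
theorem spectrum_nonHermitian_nonNormal (G : ℝ) (hG : 0 < G)
    (δ : ℝ) (hδ : δ ∈ Set.Icc (0 : ℝ) (2 * Real.pi))
    (T : lp (fun _ : ℤ × ℤ => ℂ) 2 →L[ℂ] lp (fun _ : ℤ × ℤ => ℂ) 2)
    (hT : ∀ (ψ : lp (fun _ : ℤ × ℤ => ℂ) 2) (x y : ℤ),
      T ψ (x, y) =
        (Complex.I + (G : ℂ) * Complex.exp (Complex.I * (δ : ℂ))) * ψ (x + 1, y)
        + (Complex.I + (G : ℂ) * Complex.exp (-Complex.I * (δ : ℂ))) * ψ (x - 1, y)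
        + (-Complex.I + (G : ℂ) * Complex.exp (Complex.I * (δ : ℂ))) * ψ (x, y - 1)
        + (-Complex.I + (G : ℂ) * Complex.exp (-Complex.I * (δ : ℂ))) * ψ (x, y + 1)
        - 4 * (G : ℂ) * ψ (x, y)) :
    spectrum ℂ T =
      {z : ℂ | ∃ q θ : ℝ,
        z = -4 * (G : ℂ) + 2 * Complex.I * (Real.cos θ : ℂ)
          - 2 * Complex.I * (Real.cos (q - θ) : ℂ)
          + 2 * (G : ℂ) * (Real.cos (δ + θ) : ℂ)
          + 2 * (G : ℂ) * (Real.cos (q - δ - θ) : ℂ)} := by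
  rw [spectrum_nearestNeighbour _ _ _ _ (-(4 * (G : ℂ))) T fun ψ x y ↦ by
    rw [neg_mul (4 * (G : ℂ)) (ψ (x, y)), ← sub_eq_add_neg]
    exact hT ψ x y]
  ext l
  constructor
  · rintro ⟨z, w, hz, hw, rfl⟩
    obtain ⟨a, rfl⟩ := (Complex.norm_eq_one_iff z).1 hz
    obtain ⟨b, rfl⟩ := (Complex.norm_eq_one_iff w).1 hw
    refine ⟨a + b, a, ?_⟩
    rw [symbol_exp_mul_I, show a + b - a = b by ring, show a + b - δ - a = b - δ by ring]
  · rintro ⟨q, θ, rfl⟩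
    refine ⟨Complex.exp (θ * Complex.I), Complex.exp ((q - θ : ℝ) * Complex.I),
      Complex.norm_exp_ofReal_mul_I _, Complex.norm_exp_ofReal_mul_I _, ?_⟩
    rw [symbol_exp_mul_I, show q - θ - δ = q - δ - θ by ring]
end

section
/- Inverse of a tridiagonal circulant matrix (Lemma 3.19, with conventions fixed): Let n be a prime with n ≥ 3, let α, β, γ ∈ ℂ with γ ≠ 0, and let C be the n×n complex matrix indexed by ZMod n with entries C_{jk} = β if j = k, C_{jk} = γ if j − k = 1, C_{jk} = α if k − j = 1, and C_{jk} = 0 otherwise (a tridiagonal circulant with symbol a(z) = α z^{−1} + β + γ z). Let λ₁, λ₂ be the two roots of γx² + βx + α and assume |λ₂| < 1 < |λ₁|. Then C is invertible and for all j, k ∈ ZMod n: (C⁻¹)_{jk} = (1/(γ·(λ₂ − λ₁)))·[ (1/(1 − λ₁^{−n}))·( if j ≠ k then λ₁^{−[j−k]_n} else λ₁^{−n} ) + (1/(1 − λ₂^{n}))·λ₂^{[k−j]_n} ], where [a]_n ∈ {0, 1, …, n−1} denotes the canonical representative of a mod n. In particular (C⁻¹)_{00} = (1/(γ·(λ₂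 − λ₁)))·( 1/(λ₁^{n} − 1) + 1/(1 − λ₂^{n}) ). -/
theorem ZMod.val_add_one_of_ne_neg_one {n : ℕ} [NeZero n] (hn : 1 < n) {e : ZMod n}
    (he : e + 1 ≠ 0) : (e + 1).val = e.val + 1 := by
  have : Fact (1 < n) := ⟨hn⟩
  have hlt : e.val + 1 < n := by
    refine lt_of_le_of_ne (ZMod.val_lt e) fun h => he ?_
    have h' := congrArg (Nat.cast : ℕ → ZMod n) h
    simpa using h'
  rw [ZMod.val_add_of_lt] <;> rw [ZMod.val_one]
  exact hlt

theorem ZMod.val_add_one_of_eq_neg_one {n : ℕ} [NeZero n] {e : ZMod n}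
    (he : e + 1 = 0) : e.val + 1 = n := by
  have hdvd : n ∣ e.val + 1 := by
    rw [← ZMod.natCast_eq_zero_iff]
    simpa using he
  exact le_antisymm (ZMod.val_lt e) (Nat.le_of_dvd (Nat.succ_pos _) hdvd)

/-- The `n`-periodic geometric sequence solves a first-order recurrence with a source
at the wrap-around point. -/
theorem pow_val_add_one {n : ℕ} [NeZero n] (hn : 1 < n) (x : ℂ) (e : ZMod n) :
    x ^ (e + 1).val = x * x ^ e.val + if e + 1 = 0 then 1 - x ^ n else 0 := by
  split_ifs with he
  · rw [← pow_succ', ZMod.val_add_one_of_eq_neg_one he, he, ZMod.val_zero]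
    ring
  · rw [ZMod.val_add_one_of_ne_neg_one hn he, pow_succ', add_zero]

/-- A tridiagonal circulant matrix acts as a three-term difference operator. -/
theorem tridiagonal_circulant_mul_apply {n : ℕ} [NeZero n] (hn3 : 3 ≤ n) {α β γ : ℂ}
    {C : Matrix (ZMod n) (ZMod n) ℂ}
    (hC : ∀ j k : ZMod n, C j k =
      if j = k then β else if j - k = 1 then γ else if k - j = 1 then α else 0)
    (G : Matrix (ZMod n) (ZMod n) ℂ) (j k : ZMod n) :
    (C * G) j k = β * G j k + γ * G (j - 1) k + α * G (j + 1) k := by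
  have h1 : (1 : ZMod n) ≠ 0 := by
    have : Fact (1 < n) := ⟨by omega⟩
    exact one_ne_zero
  have h2 : (1 : ZMod n) + 1 ≠ 0 := by
    intro h
    have h' : ((2 : ℕ) : ZMod n) = 0 := by
      push_cast
      rw [← h]
      norm_num
    rw [ZMod.natCast_eq_zero_iff] at h'
    exact absurd (Nat.le_of_dvd two_pos h') (by omega)
  have hsplit (m : ZMod n) : C j m * G m k =
      (if m = j then β * G m k else 0) + (if m = j - 1 then γ * G m k else 0) +
        (if m = j + 1 then α * G m k else 0) := by
    rw [hC]
    by_cases hm : m = j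
    · subst hm
      have h3 : ¬ (m = m - 1) := fun h => h1 (by linear_combination h)
      simp [h1, h3]
    by_cases hm' : m = j - 1
    · subst hm'
      have h3 : ¬ (j - 1 = j + 1) := fun h => h2 (by linear_combination -h)
      simp [h1, h3, Ne.symm hm]
    by_cases hm'' : m = j + 1
    · subst hm''
      have h3 : ¬ ((-1 : ZMod n) = 1) := fun h => h2 (by linear_combination -h)
      simp [h1, h3, hm']
    · have h3 : ¬ (j - m = 1) := fun h => hm' (by linear_combination -h)
      have h4 : ¬ (m - j = 1) := fun h => hm'' (by linear_combination h)
      simp [hm, hm', hm'', h3, h4, Ne.symm hm]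
  simp only [Matrix.mul_apply, hsplit, Finset.sum_add_distrib, Finset.sum_ite_eq',
    Finset.mem_univ, if_true]


/-- Inverse of a tridiagonal circulant matrix: for `n ≥ 3` prime and the `n×n` circulant `C`
with `β` on the diagonal, `γ` on the subdiagonal (`j - k = 1`) and `α` on the superdiagonal
(`k - j = 1`), `γ ≠ 0`, if `λ₁, λ₂` are the roots of `γx² + βx + α` with `|λ₂| < 1 < |λ₁|`,
then `C` is invertible with
`(C⁻¹)ⱼₖ = (1/(γ(λ₂-λ₁)))·[(1/(1-λ₁^{-n}))·(λ₁^{-[j-k]ₙ}` if `j ≠ k`, else `λ₁^{-n}) +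
(1/(1-λ₂ⁿ))·λ₂^{[k-j]ₙ}]`; in particular
`(C⁻¹)₀₀ = (1/(γ(λ₂-λ₁)))·(1/(λ₁ⁿ-1) + 1/(1-λ₂ⁿ))`. -/
theorem tridiagonal_circulant_inverse (n : ℕ) [NeZero n] (hn : n.Prime) (hn3 : 3 ≤ n)
    (α β γ : ℂ) (hγ : γ ≠ 0)
    (C : Matrix (ZMod n) (ZMod n) ℂ)
    (hC : ∀ j k : ZMod n, C j k =
      if j = k then β else if j - k = 1 then γ else if k - j = 1 then α else 0)
    (l₁ l₂ : ℂ)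
    (h₁ : γ * l₁ ^ 2 + β * l₁ + α = 0) (h₂ : γ * l₂ ^ 2 + β * l₂ + α = 0)
    (hlt : ‖l₂‖ < 1) (hgt : 1 < ‖l₁‖) :
    IsUnit C ∧
      (∀ j k : ZMod n, C⁻¹ j k = (1 / (γ * (l₂ - l₁))) *
        ((1 / (1 - l₁ ^ (-(n : ℤ)))) *
            (if j ≠ k then l₁ ^ (-((j - k).val : ℤ)) else l₁ ^ (-(n : ℤ)))
          + (1 / (1 - l₂ ^ n)) * l₂ ^ (k - j).val)) ∧
      C⁻¹ 0 0 = (1 / (γ * (l₂ - l₁))) * (1 / (l₁ ^ n - 1) + 1 / (1 - l₂ ^ n)) := by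
  have h1n : 1 < n := by omega
  have hl₁ : l₁ ≠ 0 := norm_pos_iff.mp (by linarith)
  have hne : l₂ - l₁ ≠ 0 := by
    intro h
    rw [sub_eq_zero.mp h] at hlt
    linarith
  have hp₁ : l₁ ^ n - 1 ≠ 0 := by
    intro h
    have := one_lt_pow₀ hgt hn.ne_zero
    rw [← norm_pow, sub_eq_zero.mp h] at this
    simp at this
  have hp₂ : 1 - l₂ ^ n ≠ 0 := by
    intro h
    have := pow_lt_one₀ (norm_nonneg _) hlt hn.ne_zero
    rw [← norm_pow, ← sub_eq_zero.mp h] at this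
    simp at this
  have hq₁ : 1 - l₁⁻¹ ^ n ≠ 0 := by
    rw [inv_pow, sub_ne_zero]
    intro h
    exact hp₁ (by rw [← inv_inv (l₁ ^ n), ← h]; simp)
  let F : ZMod n → ℂ := fun d => l₁⁻¹ * l₁⁻¹ ^ (d - 1).val / (1 - l₁⁻¹ ^ n)
  let H : ZMod n → ℂ := fun d => l₂ ^ (-d).val / (1 - l₂ ^ n)
  have hF (d : ZMod n) : F d = l₁ * F (d + 1) - if d = 0 then 1 else 0 := by
    have h := pow_val_add_one h1n l₁⁻¹ (d - 1)
    simp only [sub_add_cancel] at h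
    simp only [F, add_sub_cancel_right, h]
    generalize l₁⁻¹ ^ n = q at *
    generalize l₁⁻¹ ^ (d - 1).val = p
    split_ifs <;> field_simp <;> ring
  have hH (d : ZMod n) : H d = l₂ * H (d + 1) + if d = 0 then 1 else 0 := by
    have h := pow_val_add_one h1n l₂ (-(d + 1))
    have hd : -(d + 1) + 1 = -d := by ring
    simp only [hd, neg_eq_zero] at h
    simp only [H, h]
    split_ifs <;> field_simp
    ring
  let G : Matrix (ZMod n) (ZMod n) ℂ :=
    fun j k => 1 / (γ * (l₂ - l₁)) * (F (j - k) + H (j - k))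
  have hCG : C * G = 1 := by
    ext j k
    rw [tridiagonal_circulant_mul_apply hn3 hC, Matrix.one_apply]
    have e₁ : j - 1 - k = j - k - 1 := by ring
    have e₂ : j + 1 - k = j - k + 1 := by ring
    simp only [G, e₁, e₂, ← sub_eq_zero (a := j) (b := k)]
    generalize j - k = d
    have a₁ := hF (d - 1)
    have a₂ := hH (d - 1)
    have b₁ := hF d
    have b₂ := hH d
    rw [sub_add_cancel] at a₁ a₂
    generalize (if d - 1 = 0 then (1 : ℂ) else 0) = δ₁ at *
    generalize (if d = 0 then (1 : ℂ) else 0) = δ₀ at *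
    rw [a₁, a₂, b₁, b₂]
    field_simp
    linear_combination F (d + 1) * h₁ + H (d + 1) * h₂
  have hinv : C⁻¹ = G := Matrix.inv_eq_right_inv hCG
  have hentry (j k : ZMod n) : C⁻¹ j k = (1 / (γ * (l₂ - l₁))) *
        ((1 / (1 - l₁ ^ (-(n : ℤ)))) *
            (if j ≠ k then l₁ ^ (-((j - k).val : ℤ)) else l₁ ^ (-(n : ℤ)))
          + (1 / (1 - l₂ ^ n)) * l₂ ^ (k - j).val) := by
    have h := pow_val_add_one h1n l₁⁻¹ (j - k - 1)
    simp only [sub_add_cancel, sub_eq_zero] at h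
    simp only [hinv, G, F, H, neg_sub, zpow_neg, zpow_natCast, ← inv_pow]
    by_cases hjk : j = k
    · subst hjk
      simp only [sub_self, ZMod.val_zero, pow_zero, if_true] at h
      have h' : l₁⁻¹ * l₁⁻¹ ^ ((0 : ZMod n) - 1).val = l₁⁻¹ ^ n := by
        linear_combination -h
      simp only [sub_self, ne_eq, not_true_eq_false, if_false, h']
      ring
    · simp only [hjk, if_false, add_zero] at h
      simp only [ne_eq, hjk, not_false_eq_true, if_true, h]
      ring
  refine ⟨.of_mul_eq_one _ hCG, hentry, ?_⟩
  rw [hentry]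
  simp only [ne_eq, not_true_eq_false, if_false, sub_self, ZMod.val_zero, pow_zero, zpow_neg,
    zpow_natCast, mul_one]
  have : 1 / (1 - (l₁ ^ n)⁻¹) * (l₁ ^ n)⁻¹ = 1 / (l₁ ^ n - 1) := by
    rw [inv_pow] at hq₁
    field_simp
  rw [this]
end

section
/- Rank-one update of the spectrum of a finite matrix (Lemma 3.18): Let n ∈ ℕ, let A be an n×n complex matrix, let u, v ∈ ℂⁿ, and let F = u v* be the rank-one matrix with entries F_{jk} = u_j · conj(v_k). Let 𝒮 = { λ ∈ ℂ : A − λ·1 is invertible and ⟨v, (A − λ·1)⁻¹ u⟩ = −1 }, where ⟨v, w⟩ = Σ_j conj(v_j)·w_j. Then 𝒮 ⊆ spectrum(A + F) and spectrum(A + F) ⊆ spectrum(A) ∪ 𝒮. -/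
open Matrix

namespace Matrix

variable {m K : Type*} [Fintype m] [DecidableEq m] [Field K]

/-- Matrix determinant lemma, as an invertibility criterion for rank-one updates. -/
theorem isUnit_add_vecMulVec_iff {B : Matrix m m K} (hB : IsUnit B) (u w : m → K) :
    IsUnit (B + vecMulVec u w) ↔ w ⬝ᵥ (B⁻¹ *ᵥ u) ≠ -1 := by
  have hdet : IsUnit B.det := (isUnit_iff_isUnit_det B).mp hB
  have hfactor : B + vecMulVec u w = B * (1 + vecMulVec (B⁻¹ *ᵥ u) w) := by
    rw [mul_add, mul_one, mul_vecMulVec, mulVec_mulVec, mul_nonsing_inv B hdet, one_mulVec]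
  rw [isUnit_iff_isUnit_det, hfactor, det_mul, IsUnit.mul_iff, vecMulVec_eq Unit,
    det_one_add_replicateCol_mul_replicateRow, isUnit_iff_ne_zero (a := 1 + _), ne_eq, ne_eq,
    add_comm, add_eq_zero_iff_eq_neg]
  exact and_iff_right hdet

theorem mem_spectrum_iff_not_isUnit_sub_smul_one (B : Matrix m m K) (z : K) :
    z ∈ spectrum K B ↔ ¬ IsUnit (B - z • (1 : Matrix m m K)) := by
  rw [spectrum.mem_iff, Algebra.algebraMap_eq_smul_one, ← IsUnit.neg_iff, neg_sub]

end Matrix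

/-- Rank-one update of the spectrum of a finite matrix: for an `n×n` complex matrix `A` and
the rank-one matrix `F = u v*`, letting
`𝒮 = {λ : A - λ·1 invertible and ⟨v, (A - λ·1)⁻¹ u⟩ = -1}`, one has
`𝒮 ⊆ spectrum(A + F) ⊆ spectrum(A) ∪ 𝒮`. -/
theorem matrix_rank_one_update_spectrum (n : ℕ)
    (A : Matrix (Fin n) (Fin n) ℂ) (u v : Fin n → ℂ)
    (F : Matrix (Fin n) (Fin n) ℂ)
    (hF : ∀ j k : Fin n, F j k = u j * (starRingEnd ℂ) (v k)) :
    {z : ℂ | IsUnit (A - z • (1 : Matrix (Fin n) (Fin n) ℂ)) ∧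
        (∑ j : Fin n, (starRingEnd ℂ) (v j) *
          ((A - z • (1 : Matrix (Fin n) (Fin n) ℂ))⁻¹ *ᵥ u) j) = -1}
      ⊆ spectrum ℂ (A + F) ∧
    spectrum ℂ (A + F) ⊆ spectrum ℂ A ∪
      {z : ℂ | IsUnit (A - z • (1 : Matrix (Fin n) (Fin n) ℂ)) ∧
        (∑ j : Fin n, (starRingEnd ℂ) (v j) *
          ((A - z • (1 : Matrix (Fin n) (Fin n) ℂ))⁻¹ *ᵥ u) j) = -1} := by
  have hF' : F = vecMulVec u (star v) := by
    ext j k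
    exact hF j k
  have key (z : ℂ) (hz : IsUnit (A - z • (1 : Matrix (Fin n) (Fin n) ℂ))) :
      z ∈ spectrum ℂ (A + F) ↔ (∑ j : Fin n, (starRingEnd ℂ) (v j) *
        ((A - z • (1 : Matrix (Fin n) (Fin n) ℂ))⁻¹ *ᵥ u) j) = -1 := by
    rw [mem_spectrum_iff_not_isUnit_sub_smul_one, add_sub_right_comm, hF',
      isUnit_add_vecMulVec_iff hz, not_not]
    rfl
  refine ⟨fun z hz => (key z hz.1).mpr hz.2, fun z hz => ?_⟩
  by_cases hA : IsUnit (A - z • (1 : Matrix (Fin n) (Fin n) ℂ))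
  · exact Or.inr ⟨hA, (key z hA).mp hz⟩
  · exact Or.inl ((mem_spectrum_iff_not_isUnit_sub_smul_one A z).mpr hA)
end
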